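/- If u is a P-point ultrafilter on ℕ and e : ℕ × ℕ ≃ ℕ is a bijection used to form the finite powers u^n, then u^n is a discrete ultrafilter for every n ∈ ℕ. -/

import Mathlib

open Set Topology Filter MeasureTheory

/-- The Cantor space `2^ω = ℕ → Bool` with the product topology. -/
abbrev Cantor := ℕ → Bool

/-- `u` is an `I`-ultrafilter: for every `F : ℕ → X` there is `A ∈ u` with `F '' A ∈ I`. -/
def IUltra {X : Type*} (I : Set (Set X)) (u : Ultrafilter ℕ) : Prop :=
  ∀ F : ℕ → X, ∃ A ∈ u, F '' A ∈ I

/-- The same notion for ultrafilters on `ℕ × ℕ`. -/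
def IUltra2 {X : Type*} (I : Set (Set X)) (u : Ultrafilter (ℕ × ℕ)) : Prop :=
  ∀ F : ℕ × ℕ → X, ∃ A ∈ u, F '' A ∈ I

/-- `u` is a P-point: nonprincipal, and every countable family of members of `u`
has a pseudo-intersection in `u`. -/
def IsPPoint (u : Ultrafilter ℕ) : Prop :=
  (∀ a : ℕ, u ≠ pure a) ∧
    ∀ A : ℕ → Set ℕ, (∀ n, A n ∈ u) → ∃ B ∈ u, ∀ n, (B \ A n).Finite

/-- A subset of Cantor space is discrete: every point of `A` is isolated in `A`. -/
def DiscreteSet (A : Set Cantor) : Prop :=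
  ∀ x ∈ A, ∃ U : Set Cantor, IsOpen U ∧ A ∩ U = {x}

/-- A subset of Cantor space is scattered: every nonempty subset has an isolated point. -/
def ScatteredSet (A : Set Cantor) : Prop :=
  ∀ B ⊆ A, B.Nonempty → ∃ x ∈ B, ∃ U : Set Cantor, IsOpen U ∧ B ∩ U = {x}

/-- The basic clopen cylinder `[s]` determined by a finite binary sequence `s`. -/
def cyl (s : List Bool) : Set Cantor := {f | ∀ i : Fin s.length, f i = s.get i}

/-- `I` is an ideal: closed under subsets and finite unions. -/
def IsIdeal (I : Set (Set Cantor)) : Prop :=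
  (∀ A B : Set Cantor, A ⊆ B → B ∈ I → A ∈ I) ∧
    (∀ A B : Set Cantor, A ∈ I → B ∈ I → A ∪ B ∈ I)

/-- `I` is closed under discrete unions. -/
def ClosedUnderDiscreteUnions (I : Set (Set Cantor)) : Prop :=
  ∀ (X G : ℕ → Set Cantor), (∀ n, X n ∈ I) → (∀ n, IsOpen (G n)) →
    Pairwise (Function.onFun Disjoint G) → (⋃ n, X n ∩ G n) ∈ I

/-- A discrete ideal: an ideal closed under discrete unions. -/
def DiscreteIdeal (I : Set (Set Cantor)) : Prop := IsIdeal I ∧ ClosedUnderDiscreteUnions I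

/-- `I` is closed under scattered unions. -/
def ClosedUnderScatteredUnions (I : Set (Set Cantor)) : Prop :=
  ∀ (S : Set (List Bool)) (X : List Bool → Set Cantor),
    S.WellFoundedOn (fun s t => cyl s ⊂ cyl t) → (∀ s ∈ S, X s ∈ I) →
    (⋃ s ∈ S, X s ∩ cyl s) ∈ I

/-- The sum `∑_u v_n`: the ultrafilter on `ℕ × ℕ` with
`X ∈ ∑_u v_n ↔ {n | {m | (n, m) ∈ X} ∈ v n} ∈ u`. -/
def ultraSum (u : Ultrafilter ℕ) (v : ℕ → Ultrafilter ℕ) : Ultrafilter (ℕ × ℕ) :=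
  u.bind fun n => (v n).map fun m => (n, m)

/-- Iterated derivative: `dA = {x ∈ A : x is an accumulation point of A}`;
`A` has level `≤ k` iff `d^k A = ∅`. -/
def HasLevelLE (k : ℕ) (A : Set Cantor) : Prop :=
  (fun B : Set Cantor => {x ∈ B | AccPt x (𝓟 B)})^[k] A = ∅

/-- Finite Fubini powers of `u` (relative to a pairing bijection `e`). -/
noncomputable def ultraPow (e : ℕ × ℕ ≃ ℕ) (u : Ultrafilter ℕ) : ℕ → Ultrafilter ℕ
  | 0 => pure 0
  | n + 1 => Ultrafilter.map e (ultraSum u fun _ => ultraPow e u n)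

/-- `u^ω = ∑_u ⟨u^n : n < ω⟩`, an ultrafilter on `ℕ × ℕ`. -/
noncomputable def ultraPowOmega (e : ℕ × ℕ ≃ ℕ) (u : Ultrafilter ℕ) : Ultrafilter (ℕ × ℕ) :=
  ultraSum u (ultraPow e u)

/-- The order type of a set of ordinals. -/
noncomputable def tp (X : Set Ordinal) : Ordinal := Ordinal.type ((· < ·) : X → X → Prop)

/-- The first uncountable ordinal. -/
noncomputable def omega1 : Ordinal := (Cardinal.aleph 1).ord

/-- `u` is an `α`-ultrafilter (`I_α`-ultrafilter, where `I_α` is the family of subsets of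
`ω₁` of order type `≤ α`). -/
def AlphaUltra (α : Ordinal) (u : Ultrafilter ℕ) : Prop :=
  ∀ F : ℕ → Ordinal, (∀ n, F n < omega1) → ∃ A ∈ u, tp (F '' A) ≤ α

/-- `u` is a `J_α`-ultrafilter (`J_α` is the family of subsets of `ω₁` of order type `< α`). -/
def JUltra (α : Ordinal) (u : Ultrafilter ℕ) : Prop :=
  ∀ F : ℕ → Ordinal, (∀ n, F n < omega1) → ∃ A ∈ u, tp (F '' A) < α

/-- The `J_α`-ultrafilter notion for ultrafilters on `ℕ × ℕ`. -/
def JUltra2 (α : Ordinal) (u : Ultrafilter (ℕ × ℕ)) : Prop :=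
  ∀ F : ℕ × ℕ → Ordinal, (∀ p, F p < omega1) → ∃ A ∈ u, tp (F '' A) < α

/-- A closed set of finite Cantor–Bendixson rank at most `k`. -/
def IsClosedOfRankLE {X : Type*} [TopologicalSpace X] (k : ℕ) (K : Set X) : Prop :=
  IsClosed K ∧ derivedSet^[k] K = ∅

/-- Along `v`, every sequence is concentrated on a closed set of rank at most `k`. -/
def ConcentratesOnRankLE (X : Type*) [TopologicalSpace X] (k : ℕ) (v : Ultrafilter ℕ) : Prop :=
  ∀ F : ℕ → X, ∃ K : Set X, IsClosedOfRankLE k K ∧ F ⁻¹' K ∈ v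

theorem derivedSet_singleton_eq_empty {X : Type*} [TopologicalSpace X] [T1Space X] (x : X) :
    derivedSet ({x} : Set X) = ∅ := by
  refine eq_empty_of_forall_notMem fun z hz => ?_
  obtain rfl : z = x := (isClosed_iff_derivedSet_subset {x}).1 isClosed_singleton hz
  obtain ⟨w, hw, hne⟩ := accPt_iff_nhds.1 hz univ univ_mem
  exact hne hw.2

/-- If the sets `K i` converge to `y`, a point other than `y` accumulated by their union is
accumulated by one of them. -/
theorem derivedSet_subset_insert_iUnion {X ι : Type*} [TopologicalSpace X] [T2Space X]
    {y : X} {K : ι → Set X} (hK : ∀ U ∈ 𝓝 y, {i | ¬ K i ⊆ U}.Finite) {L : Set X}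
    (hL : L ⊆ insert y (⋃ i, K i)) :
    derivedSet L ⊆ insert y (⋃ i, derivedSet (K i)) := by
  intro z hz
  by_cases hzy : z = y
  · exact Or.inl hzy
  right
  obtain ⟨V, U, hV, hU, hzV, hyU, hVU⟩ := t2_separation hzy
  have hfin := hK U (hU.mem_nhds hyU)
  rw [mem_derivedSet, accPt_iff_frequently] at hz
  have hfreq : ∃ᶠ w in 𝓝 z, ∃ i ∈ {i | ¬ K i ⊆ U}, w ≠ z ∧ w ∈ K i := by
    refine (hz.and_eventually (hV.mem_nhds hzV)).mono ?_
    rintro w ⟨⟨hwz, hwL⟩, hwV⟩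
    have hwU : w ∉ U := fun h => hVU.le_bot ⟨hwV, h⟩
    rcases hL hwL with rfl | hw
    · exact absurd hyU hwU
    · obtain ⟨i, hi⟩ := mem_iUnion.1 hw
      exact ⟨i, fun h => hwU (h hi), hwz, hi⟩
  by_contra hcon
  have hev : ∀ᶠ w in 𝓝 z, ∀ i ∈ {i | ¬ K i ⊆ U}, ¬ (w ≠ z ∧ w ∈ K i) :=
    (eventually_all_finite hfin).2 fun i _ => not_frequently.1 fun h =>
      hcon (mem_iUnion.2 ⟨i, accPt_iff_frequently.2 h⟩)
  exact hfreq (hev.mono fun w hw ⟨i, hi, h⟩ => hw i hi h)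

theorem iterate_derivedSet_subset {X : Type*} [TopologicalSpace X] [T1Space X] {K : Set X}
    (hK : IsClosed K) (k : ℕ) : derivedSet^[k] K ⊆ K := by
  induction k generalizing K with
  | zero => exact Subset.rfl
  | succ k ih =>
    rw [Function.iterate_succ_apply]
    exact (ih (isClosed_derivedSet K)).trans ((isClosed_iff_derivedSet_subset K).1 hK)

theorem IsClosedOfRankLE.inter {X : Type*} [TopologicalSpace X] {k : ℕ} {K C : Set X}
    (hK : IsClosedOfRankLE k K) (hC : IsClosed C) : IsClosedOfRankLE k (K ∩ C) :=
  ⟨hK.1.inter hC, subset_empty_iff.1 <|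
    (Monotone.iterate (fun _ _ h => derivedSet_mono _ _ h) k inter_subset_left).trans hK.2.le⟩

/-- The union of closed sets of rank at most `k` converging to `y`, together with `y`, is closed
of rank at most `k + 1`. -/
theorem IsClosedOfRankLE.insert_iUnion {X ι : Type*} [TopologicalSpace X] [T2Space X] {k : ℕ}
    {y : X} {K : ι → Set X} (hK : ∀ i, IsClosedOfRankLE k (K i))
    (hconv : ∀ U ∈ 𝓝 y, {i | ¬ K i ⊆ U}.Finite) :
    IsClosedOfRankLE (k + 1) (insert y (⋃ i, K i)) := by
  have hiter : ∀ j, derivedSet^[j] (insert y (⋃ i, K i)) ⊆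
      insert y (⋃ i, derivedSet^[j] (K i)) := by
    intro j
    induction j with
    | zero => exact Subset.rfl
    | succ j ih =>
      simp only [Function.iterate_succ_apply']
      refine derivedSet_subset_insert_iUnion (fun U hU => (hconv U hU).subset ?_) ih
      exact fun i hi h => hi ((iterate_derivedSet_subset (hK i).1 j).trans h)
  constructor
  · rw [isClosed_iff_derivedSet_subset]
    refine (hiter 1).trans (insert_subset_insert (iUnion_mono fun i => ?_))
    exact iterate_derivedSet_subset (hK i).1 1
  · rw [Function.iterate_succ_apply', ← subset_empty_iff, ← derivedSet_singleton_eq_empty y]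
    refine derivedSet_mono _ _ ((hiter k).trans ?_)
    simp [(hK _).2]

theorem mem_ultraSum {u : Ultrafilter ℕ} {v : ℕ → Ultrafilter ℕ} {s : Set (ℕ × ℕ)} :
    s ∈ ultraSum u v ↔ {n | {m | (n, m) ∈ s} ∈ v n} ∈ u :=
  Iff.rfl

theorem IsPPoint.exists_finite_dist {X : Type*} [MetricSpace X] [CompactSpace X]
    {u : Ultrafilter ℕ} (hu : IsPPoint u) (x : ℕ → X) :
    ∃ y, ∃ B ∈ u, ∀ ε > 0, {n ∈ B | ε ≤ dist (x n) y}.Finite := by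
  obtain ⟨y, -, hy⟩ := isCompact_univ.ultrafilter_le_nhds (u.map x) (by simp)
  obtain ⟨B, hB, hfin⟩ := hu.2 (fun k => {n | dist (x n) y < 1 / (k + 1)})
    fun k => hy (Metric.ball_mem_nhds y Nat.one_div_pos_of_nat)
  refine ⟨y, B, hB, fun ε hε => ?_⟩
  obtain ⟨k, hk⟩ := exists_nat_one_div_lt hε
  refine (hfin k).subset fun n hn => ⟨hn.1, fun h => ?_⟩
  exact (h.trans hk).not_ge hn.2

theorem ConcentratesOnRankLE.map_ultraSum {X : Type*} [MetricSpace X] [CompactSpace X]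
    {u v : Ultrafilter ℕ} (hu : IsPPoint u) {k : ℕ} (hv : ConcentratesOnRankLE X k v)
    (e : ℕ × ℕ ≃ ℕ) :
    ConcentratesOnRankLE X (k + 1) (Ultrafilter.map e (ultraSum u fun _ => v)) := by
  intro F
  choose K hK hKv using fun n => hv fun m => F (e (n, m))
  have hlim : ∀ n, ∃ x, (v.map fun m => F (e (n, m)) : Filter X) ≤ 𝓝 x := fun n => by
    obtain ⟨x, -, hx⟩ :=
      isCompact_univ.ultrafilter_le_nhds (v.map fun m => F (e (n, m))) (by simp)
    exact ⟨x, hx⟩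
  choose x hx using hlim
  obtain ⟨y, B, hB, hfin⟩ := hu.exists_finite_dist x
  let L : B → Set X := fun n => K n ∩ Metric.closedBall (x n) (1 / ((n : ℕ) + 1))
  refine ⟨insert y (⋃ n, L n), .insert_iUnion (fun n => (hK n).inter Metric.isClosed_closedBall)
    fun U hU => ?_, ?_⟩
  · obtain ⟨ε, hε, hεU⟩ := Metric.mem_nhds_iff.1 hU
    obtain ⟨N, hN⟩ := exists_nat_one_div_lt (half_pos hε)
    refine (((hfin (ε / 2) (half_pos hε)).union (finite_lt_nat N)).preimage
      Subtype.val_injective.injOn).subset fun n hn => ?_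
    by_contra hcon
    simp only [mem_preimage, mem_union, mem_ofPred_eq, n.2, true_and, not_or, not_le, not_lt]
      at hcon
    refine hn fun z hz => hεU ?_
    have hzn : dist z (x n) ≤ 1 / ((n : ℕ) + 1) := hz.2
    have hmono := Nat.one_div_le_one_div (α := ℝ) hcon.2
    rw [Metric.mem_ball]
    linarith [dist_triangle z (x n) y]
  · rw [Ultrafilter.mem_map, mem_ultraSum]
    filter_upwards [hB] with n hn
    have hball : (fun m => F (e (n, m))) ⁻¹' Metric.closedBall (x n) (1 / (n + 1)) ∈ v :=
      hx n (Metric.closedBall_mem_nhds _ Nat.one_div_pos_of_nat)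
    filter_upwards [hKv n, hball] with m hm hm'
    exact Or.inr (mem_iUnion.2 ⟨⟨n, hn⟩, hm, hm'⟩)

theorem discreteSet_of_subset_diff_derivedSet {A K : Set Cantor} (hA : A ⊆ K \ derivedSet K) :
    DiscreteSet A := by
  intro x hx
  have hacc := (hA hx).2
  simp only [mem_derivedSet, accPt_iff_nhds, not_forall, not_exists, not_and, not_not] at hacc
  obtain ⟨V, hV, hVx⟩ := hacc
  obtain ⟨U, hUV, hU, hxU⟩ := mem_nhds_iff.1 hV
  refine ⟨U, hU, Subset.antisymm (fun z hz => ?_) (singleton_subset_iff.2 ⟨hx, hxU⟩)⟩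
  exact hVx z ⟨hUV hz.2, (hA hz.1).1⟩

theorem exists_discreteSet_image {v : Ultrafilter ℕ} {F : ℕ → Cantor} {k : ℕ} {K : Set Cantor}
    (hK : derivedSet^[k] K = ∅) (hF : F ⁻¹' K ∈ v) : ∃ A ∈ v, DiscreteSet (F '' A) := by
  induction k generalizing K with
  | zero =>
    obtain rfl : K = ∅ := hK
    exact absurd hF v.empty_notMem
  | succ k ih =>
    by_cases h : F ⁻¹' derivedSet K ∈ v
    · exact ih hK h
    · refine ⟨F ⁻¹' (K \ derivedSet K), ?_,
        discreteSet_of_subset_diff_derivedSet (image_preimage_subset F _)⟩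
      filter_upwards [hF, Ultrafilter.compl_mem_iff_notMem.2 h] with n hn hn'
      exact ⟨hn, hn'⟩

theorem concentratesOnRankLE_ultraPow {X : Type*} [MetricSpace X] [CompactSpace X]
    {u : Ultrafilter ℕ} (hu : IsPPoint u) (e : ℕ × ℕ ≃ ℕ) (n : ℕ) :
    ConcentratesOnRankLE X (n + 1) (ultraPow e u n) := by
  induction n with
  | zero =>
    exact fun F => ⟨{F 0}, ⟨isClosed_singleton, derivedSet_singleton_eq_empty _⟩,
      Ultrafilter.mem_pure.2 rfl⟩
  | succ n ih => exact ih.map_ultraSum hu e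

/-- if `u` is a P-point then `u^n` is discrete for all `n < ω`. -/
theorem stmt14 (u : Ultrafilter ℕ) (hu : IsPPoint u) (e : ℕ × ℕ ≃ ℕ) (n : ℕ) :
    IUltra {A : Set Cantor | DiscreteSet A} (ultraPow e u n) := by
  intro F
  let _ := TopologicalSpace.metrizableSpaceMetric Cantor
  obtain ⟨K, hK, hF⟩ := concentratesOnRankLE_ultraPow hu e n F
  exact exists_discreteSet_image hK.2 hF
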